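/- arXiv:2107.03196 — 6 statements merged into one kernel-verified Lean document; each statement's English description precedes it below -/
import Mathlib

section
/- Let r be an N×N complex positive semidefinite Hermitian matrix. Then s_v(r) ≤ s_w(r) ≤ s_v(r) + N; that is, the reduced von Neumann entropy and the reduced Wehrl entropy bound each other from both sides, differing by at most the number of modes N. (Proposition 5 of the paper, with the Boltzmann constant set to 1.) -/
open scoped ComplexOrder

/-- The reduced von Neumann entropy of a Hermitian matrix `r` (Boltzmann constant 1):
`s_v(r) = Σ_k [(λ_k+1)·log(λ_k+1) − λ_k·log λ_k]` where `λ_k` are the eigenvalues of `r`. -/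
noncomputable def reducedVonNeumannEntropy {n : Type*} [Fintype n] [DecidableEq n]
    (r : Matrix n n ℂ) (hr : r.IsHermitian) : ℝ :=
  ∑ k, ((hr.eigenvalues k + 1) * Real.log (hr.eigenvalues k + 1)
    - hr.eigenvalues k * Real.log (hr.eigenvalues k))

/-- The reduced Wehrl entropy of a Hermitian matrix `r` (Boltzmann constant 1):
`s_w(r) = Σ_k log(λ_k+1) + N` where `λ_k` are the eigenvalues of `r`. -/
noncomputable def reducedWehrlEntropy {n : Type*} [Fintype n] [DecidableEq n]
    (r : Matrix n n ℂ) (hr : r.IsHermitian) : ℝ :=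
  (∑ k, Real.log (hr.eigenvalues k + 1)) + Fintype.card n

/-- For `x ≥ 0`, the increment `x * (log (x + 1) - log x)` is nonnegative. -/
theorem mul_log_le_mul_log_add_one {x : ℝ} (hx : 0 ≤ x) :
    x * Real.log x ≤ x * Real.log (x + 1) := by
  rcases hx.eq_or_lt with rfl | hx
  · simp
  · gcongr
    linarith

/-- For `x ≥ 0`, the increment `x * (log (x + 1) - log x)` is at most `1`. -/
theorem mul_log_add_one_le_mul_log_add_one {x : ℝ} (hx : 0 ≤ x) :
    x * Real.log (x + 1) ≤ x * Real.log x + 1 := by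
  rcases hx.eq_or_lt with rfl | hx
  · simp
  · have h := Real.log_le_sub_one_of_pos (show 0 < (x + 1) / x by positivity)
    rw [Real.log_div (by positivity) hx.ne'] at h
    have h' := mul_le_mul_of_nonneg_left h hx.le
    have e : x * ((x + 1) / x - 1) = 1 := by field_simp; ring
    linarith

/-- Proposition 5: for a positive semidefinite Hermitian `N×N` matrix `r`,
`s_v(r) ≤ s_w(r) ≤ s_v(r) + N`. -/
theorem reduced_entropies_bound (N : ℕ) (r : Matrix (Fin N) (Fin N) ℂ)
    (hr : r.PosSemidef) :
    reducedVonNeumannEntropy r hr.isHermitian ≤ reducedWehrlEntropy r hr.isHermitian ∧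
    reducedWehrlEntropy r hr.isHermitian ≤ reducedVonNeumannEntropy r hr.isHermitian + N := by
  have hcard : (N : ℝ) = ∑ _k : Fin N, (1 : ℝ) := by simp
  unfold reducedVonNeumannEntropy reducedWehrlEntropy
  rw [Fintype.card_fin, hcard, ← Finset.sum_add_distrib, ← Finset.sum_add_distrib]
  constructor <;> refine Finset.sum_le_sum fun k _ => ?_
  · linarith [mul_log_add_one_le_mul_log_add_one (hr.eigenvalues_nonneg k)]
  · linarith [mul_log_le_mul_log_add_one (hr.eigenvalues_nonneg k)]
end

section
/- Let a, b, c₊, c₋ be real numbers such that V := V_sf(a,b,c₊,c₋) satisfies that V + (i/2)J is positive semidefinite. Put m := (c₊+c₋)/2 and V' := V_sf(a,b,m,m). Then: (i) V' + (i/2)J is positive semidefinite; (ii) the product of the two correlation parameters of V' is nonnegative (m·m ≥ 0), so by the necessary entanglement condition c₊c₋ < 0 the state described by V' is separable; and (iii) T V' T† = T V T†, i.e. V' determines the same single-particle density matrix (reduced state of the field) as V. (Mathematical content of Proposition 4: the reduced state of the field contains no information about entanglement in two-mode Gaussian states.) -/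
open Matrix
open scoped ComplexOrder

/-- The two-mode symplectic form `J = J₂ ⊕ J₂`, regarded as a complex matrix. -/
def J4 : Matrix (Fin 4) (Fin 4) ℂ :=
  !![0, 1, 0, 0; -1, 0, 0, 0; 0, 0, 0, 1; 0, 0, -1, 0]

/-- The standard-form covariance matrix `V_sf(a,b,c₊,c₋)`, regarded as a complex matrix. -/
def Vsf (a b cp cm : ℝ) : Matrix (Fin 4) (Fin 4) ℂ :=
  !![(a : ℂ), 0, (cp : ℂ), 0;
     0, (a : ℂ), 0, (cm : ℂ);
     (cp : ℂ), 0, (b : ℂ), 0;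
     0, (cm : ℂ), 0, (b : ℂ)]

/-- The two-mode transfer matrix `T` with rows `(1/√2)(1, i, 0, 0)` and `(1/√2)(0, 0, 1, i)`. -/
noncomputable def T2 : Matrix (Fin 2) (Fin 4) ℂ :=
  !![(Real.sqrt 2 : ℂ)⁻¹, Complex.I * (Real.sqrt 2 : ℂ)⁻¹, 0, 0;
     0, 0, (Real.sqrt 2 : ℂ)⁻¹, Complex.I * (Real.sqrt 2 : ℂ)⁻¹]

lemma J4_conjTranspose : J4ᴴ = -J4 := by
  ext i j
  fin_cases i <;> fin_cases j <;> simp [J4]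

/-- Conjugating by the symplectic form exchanges the two correlation parameters. Averaging with
the result replaces both by their mean, and leaves the symplectic form unchanged. -/
lemma Vsf_mean_add_smul_J4 (a b cp cm : ℝ) (z : ℂ) :
    Vsf a b ((cp + cm) / 2) ((cp + cm) / 2) + z • J4 =
      (1 / 2 : ℂ) • ((Vsf a b cp cm + z • J4) + J4 * (Vsf a b cp cm + z • J4) * J4ᴴ) := by
  rw [J4_conjTranspose]
  ext i j
  fin_cases i <;> fin_cases j <;>
    simp [Vsf, J4] <;> ring

/-- The reduced state of the field depends on the correlation parameters only through their sum. -/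
lemma T2_mul_Vsf_mul_conjTranspose (a b cp cm : ℝ) :
    T2 * Vsf a b cp cm * T2ᴴ = !![(a : ℂ), (cp + cm) / 2; (cp + cm) / 2, (b : ℂ)] := by
  have h : ((Real.sqrt 2 : ℂ)⁻¹) ^ 2 = 1 / 2 := by
    rw [inv_pow, ← Complex.ofReal_pow, Real.sq_sqrt zero_le_two]
    norm_num
  ext i j
  fin_cases i <;> fin_cases j <;>
    simp [Vsf, T2, Matrix.mul_apply, Fin.sum_univ_four] <;>
    grind [Complex.I_sq]

/-- Proposition 4 (mathematical content): if `V := V_sf(a,b,c₊,c₋)` satisfies the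
uncertainty principle `V + (i/2)J ⪰ 0`, then with `m := (c₊+c₋)/2` the matrix
`V' := V_sf(a,b,m,m)` (i) also satisfies the uncertainty principle, (ii) has
`m·m ≥ 0`, hence describes a separable state by the criterion `c₊c₋ < 0`, and
(iii) has the same reduced state of the field: `T V' T† = T V T†`. -/
theorem rsf_no_entanglement_info (a b cp cm : ℝ)
    (hV : (Vsf a b cp cm + (Complex.I / 2) • J4).PosSemidef) :
    (Vsf a b ((cp + cm) / 2) ((cp + cm) / 2) + (Complex.I / 2) • J4).PosSemidef ∧
    0 ≤ ((cp + cm) / 2) * ((cp + cm) / 2) ∧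
    T2 * Vsf a b ((cp + cm) / 2) ((cp + cm) / 2) * T2ᴴ = T2 * Vsf a b cp cm * T2ᴴ := by
  refine ⟨?_, mul_self_nonneg _, ?_⟩
  · rw [Vsf_mean_add_smul_J4]
    exact (hV.add (hV.mul_mul_conjTranspose_same J4)).smul (one_div_nonneg.2 zero_le_two)
  · simp only [T2_mul_Vsf_mul_conjTranspose]
    push_cast
    simp only [add_halves]
end

section
/- Let a, b, c₊, c₋ be real numbers. If V_sf(a,b,c₊,c₋) + (i/2)J is positive semidefinite, then V_sf(a,b,c₋,c₊) + (i/2)J is positive semidefinite. (Swapping the two correlation parameters of a physical standard-form covariance matrix again yields a physical covariance matrix; auxiliary step for Proposition 4.) -/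
open Matrix
open scoped ComplexOrder

/-- Auxiliary step for Proposition 4: swapping the two correlation parameters of a
physical standard-form covariance matrix again yields a physical covariance matrix. -/
theorem swap_correlations_posSemidef (a b cp cm : ℝ)
    (hV : (Vsf a b cp cm + (Complex.I / 2) • J4).PosSemidef) :
    (Vsf a b cm cp + (Complex.I / 2) • J4).PosSemidef := by
  have h : Vsf a b cm cp + (Complex.I / 2) • J4 =
      ((Vsf a b cp cm + (Complex.I / 2) • J4)ᵀ).submatrix ![1, 0, 3, 2] ![1, 0, 3, 2] := by
    ext i j
    fin_cases i <;> fin_cases j <;> simp [Vsf, J4]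
  rw [h]
  exact hV.transpose.submatrix _
end

section
/- Let V be a 2N×2N real symmetric matrix, regarded as a complex matrix, such that V + (i/2)J is positive semidefinite (the Heisenberg uncertainty principle). Then the N×N matrix T V T† − (1/2)·1_N is positive semidefinite. (Every covariance matrix satisfying the uncertainty principle gives rise to a positive semidefinite correlation matrix of the reduced state of the field.) -/
open Matrix
open scoped ComplexOrder

/-- The transfer matrix `T`: the `N × 2N` complex matrix with (0-indexed) entries
`T k (2k) = 1/√2`, `T k (2k+1) = i/√2`, and all other entries zero. -/
noncomputable def transferMatrix (N : ℕ) : Matrix (Fin N) (Fin (2 * N)) ℂ :=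
  Matrix.of fun k j =>
    if (j : ℕ) = 2 * (k : ℕ) then (Real.sqrt 2 : ℂ)⁻¹
    else if (j : ℕ) = 2 * (k : ℕ) + 1 then Complex.I * (Real.sqrt 2 : ℂ)⁻¹
    else 0

/-- The symplectic form `J`: the `2N × 2N` complex matrix given by the direct sum of
`N` copies of the block `J₂ = [[0,1],[−1,0]]`. -/
def symplecticForm (N : ℕ) : Matrix (Fin (2 * N)) (Fin (2 * N)) ℂ :=
  Matrix.of fun i j =>
    if (i : ℕ) % 2 = 0 ∧ (j : ℕ) = (i : ℕ) + 1 then 1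
    else if (j : ℕ) % 2 = 0 ∧ (i : ℕ) = (j : ℕ) + 1 then -1
    else 0

lemma sum_transferMatrix_mul (N : ℕ) (k : Fin N) (f : Fin (2 * N) → ℂ) :
    ∑ m, transferMatrix N k m * f m =
      (Real.sqrt 2 : ℂ)⁻¹ * f ⟨2 * k, by omega⟩ +
        Complex.I * (Real.sqrt 2 : ℂ)⁻¹ * f ⟨2 * k + 1, by omega⟩ := by
  rw [Fintype.sum_eq_add (⟨2 * k, by omega⟩ : Fin (2 * N)) ⟨2 * k + 1, by omega⟩ (by simp)]
  · simp [transferMatrix]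
  · rintro m ⟨h₁, h₂⟩
    rw [Ne, Fin.ext_iff] at h₁ h₂
    simp_all [transferMatrix]

lemma transferMatrix_mul_conjTranspose (N : ℕ) :
    transferMatrix N * (transferMatrix N)ᴴ = 1 := by
  have h2 : (Real.sqrt 2 : ℂ)⁻¹ * (Real.sqrt 2 : ℂ)⁻¹ = 1 / 2 := by
    rw [← mul_inv, ← Complex.ofReal_mul, Real.mul_self_sqrt (by norm_num)]
    norm_num
  ext k l
  rw [mul_apply, sum_transferMatrix_mul, one_apply]
  by_cases h : k = l
  · subst h
    simp only [conjTranspose_apply, transferMatrix, of_apply]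
    simp
    linear_combination 2 * h2 - (Real.sqrt 2 : ℂ)⁻¹ * (Real.sqrt 2 : ℂ)⁻¹ * Complex.I_sq
  · have h' : (k : ℕ) ≠ l := fun e => h (Fin.ext e)
    simp only [conjTranspose_apply, transferMatrix, of_apply]
    rw [if_neg (by omega), if_neg (by omega), if_neg (by omega), if_neg (by omega), if_neg h]
    simp

lemma transferMatrix_mul_symplecticForm (N : ℕ) :
    transferMatrix N * symplecticForm N = -Complex.I • transferMatrix N := by
  ext k j
  rw [mul_apply, sum_transferMatrix_mul]
  simp only [symplecticForm, transferMatrix, of_apply, Matrix.smul_apply, smul_eq_mul]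
  by_cases h₀ : (j : ℕ) = 2 * k
  · rw [if_neg (by omega), if_neg (by omega), if_neg (by omega), if_pos (by omega),
      if_pos (by omega)]
    ring
  by_cases h₁ : (j : ℕ) = 2 * k + 1
  · rw [if_pos (by omega), if_neg (by omega), if_neg (by omega), if_neg (by omega),
      if_pos (by omega)]
    linear_combination (Real.sqrt 2 : ℂ)⁻¹ * Complex.I_sq
  · rw [if_neg (by omega), if_neg (by omega), if_neg (by omega), if_neg (by omega),
      if_neg (by omega), if_neg (by omega)]
    ring

lemma symplecticForm_transpose (N : ℕ) : (symplecticForm N)ᵀ = -symplecticForm N := by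
  ext i j
  simp only [symplecticForm, transpose_apply, of_apply, Matrix.neg_apply]
  split_ifs <;> first | omega | simp

/-- if `V` is a `2N × 2N` real symmetric matrix (viewed as complex) with
`V + (i/2)J ⪰ 0` (the Heisenberg uncertainty principle), then the correlation matrix
`T V T† − (1/2)·1` is positive semidefinite. -/
theorem correlation_matrix_posSemidef (N : ℕ) (hN : 1 ≤ N)
    (V : Matrix (Fin (2 * N)) (Fin (2 * N)) ℂ)
    (hreal : ∀ i j, (V i j).im = 0) (hsym : Vᵀ = V)
    (hV : (V + (Complex.I / 2) • symplecticForm N).PosSemidef) :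
    (transferMatrix N * V * (transferMatrix N)ᴴ
      - (1 / 2 : ℂ) • (1 : Matrix (Fin N) (Fin N) ℂ)).PosSemidef := by
  have h := hV.transpose.mul_mul_conjTranspose_same (transferMatrix N)
  rw [transpose_add, transpose_smul, hsym, symplecticForm_transpose, Matrix.mul_add,
    Matrix.add_mul, Matrix.mul_smul, Matrix.mul_neg, transferMatrix_mul_symplecticForm,
    ← neg_smul, neg_neg, smul_smul, Matrix.smul_mul, transferMatrix_mul_conjTranspose] at h
  have hI : Complex.I / 2 * Complex.I = -(1 / 2) := by
    linear_combination (1 / 2 : ℂ) * Complex.I_sq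
  rwa [hI, neg_smul, ← sub_eq_add_neg] at h
end

section
/- Let N ≥ 1, α ∈ ℂᴺ, and let r be an N×N complex Hermitian matrix such that M := r − α α† + 1_N is positive definite. Let Q : ℂᴺ → [0,∞) be measurable with ∫ Q dμ = 1, ∫ β_k Q(β) dμ(β) = α_k for every k, ∫ β_k·conj(β_{k'}) Q(β) dμ(β) = r_{kk'} + δ_{kk'} for all k, k', and with Q·log Q integrable with respect to μ. Then −∫ Q(β) log Q(β) dμ(β) ≤ log det M + N, where log det M is real since M is Hermitian positive definite. (The reduced Wehrl entropy is the maximal Wehrl entropy among all states with a fixed reduced state of the field, as established in Appendix C.) -/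
open Matrix MeasureTheory
open scoped ComplexOrder

/-- The measure on `ℂᴺ` (identified with `ℝ^{2N}`) given by Lebesgue measure divided
by `πᴺ`. -/
noncomputable def husimiMeasure (N : ℕ) : Measure (Fin N → ℂ) :=
  ((ENNReal.ofReal Real.pi) ^ N)⁻¹ • (volume : Measure (Fin N → ℂ))

namespace MeasureTheory

/-- Gibbs' inequality for a nonnegative function `f` and a positive subnormalised function `g`. -/
theorem neg_integral_mul_log_self_le {X : Type*} [MeasurableSpace X] {μ : Measure X} {f g : X → ℝ}
    (hf : ∀ x, 0 ≤ f x) (hg : ∀ x, 0 < g x) (hfi : Integrable f μ) (hgi : Integrable g μ)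
    (hle : ∫ x, g x ∂μ ≤ ∫ x, f x ∂μ)
    (hff : Integrable (fun x => f x * Real.log (f x)) μ)
    (hfg : Integrable (fun x => f x * Real.log (g x)) μ) :
    -∫ x, f x * Real.log (f x) ∂μ ≤ -∫ x, f x * Real.log (g x) ∂μ := by
  have key : ∫ x, (f x * Real.log (g x) - f x * Real.log (f x)) ∂μ ≤ ∫ x, (g x - f x) ∂μ := by
    refine integral_mono (hfg.sub hff) (hgi.sub hfi) fun x => ?_
    rcases (hf x).eq_or_lt with h | h
    · simpa [← h] using (hg x).le
    · have := mul_le_mul_of_nonneg_left (Real.log_le_sub_one_of_pos (div_pos (hg x) h)) h.le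
      rw [Real.log_div (hg x).ne' h.ne', mul_sub, mul_sub, mul_div_cancel₀ _ h.ne', mul_one] at this
      exact this
  rw [integral_sub hfg hff, integral_sub hgi hfi] at key
  linarith

end MeasureTheory

section Gaussian

variable {ι : Type*} [Fintype ι]

theorem integral_exp_neg_sum_norm_sq :
    ∫ y : ι → ℂ, Real.exp (-∑ i, ‖y i‖ ^ 2) = Real.pi ^ Fintype.card ι := by
  have h : ∫ z : ℂ, Real.exp (-‖z‖ ^ 2) = Real.pi := by
    simpa using GaussianFourier.integral_rexp_neg_mul_sq_norm (V := ℂ) one_pos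
  simp only [← Finset.sum_neg_distrib, Real.exp_sum]
  rw [integral_fintype_prod_volume_eq_pow (fun z : ℂ => Real.exp (-‖z‖ ^ 2)), h]

variable [DecidableEq ι]

theorem map_mulVec_volume {B : Matrix ι ι ℂ} (hB : B.det ≠ 0) :
    Measure.map B.mulVec (volume : Measure (ι → ℂ)) =
      ENNReal.ofReal (‖B.det‖ ^ 2)⁻¹ • volume := by
  have hdet : LinearMap.det ((Matrix.toLin' B).restrictScalars ℝ) = ‖B.det‖ ^ 2 := by
    rw [LinearMap.det_restrictScalars, LinearMap.det_toLin', Algebra.norm_complex_eq]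
    simp [Complex.normSq_eq_norm_sq]
  have h := Measure.map_linearMap_addHaar_eq_smul_addHaar (volume : Measure (ι → ℂ))
    (f := (Matrix.toLin' B).restrictScalars ℝ) (by rw [hdet]; positivity)
  rw [hdet, abs_of_nonneg (by positivity)] at h
  exact h

theorem integral_exp_neg_sum_norm_sq_mulVec_sub (α : ι → ℂ) {B : Matrix ι ι ℂ} (hB : B.det ≠ 0) :
    ∫ x : ι → ℂ, Real.exp (-∑ i, ‖(B *ᵥ (x - α)) i‖ ^ 2) =
      (‖B.det‖ ^ 2)⁻¹ * Real.pi ^ Fintype.card ι := by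
  rw [integral_sub_right_eq_self (fun x : ι → ℂ => Real.exp (-∑ i, ‖(B *ᵥ x) i‖ ^ 2)) α,
    ← integral_map (φ := B.mulVec) (f := fun y : ι → ℂ => Real.exp (-∑ i, ‖y i‖ ^ 2))
      (by fun_prop) (Continuous.aestronglyMeasurable (by fun_prop)),
    map_mulVec_volume hB, integral_smul_measure, integral_exp_neg_sum_norm_sq,
    ENNReal.toReal_ofReal (by positivity), smul_eq_mul]

theorem integrable_exp_neg_sum_norm_sq_mulVec_sub (α : ι → ℂ) {B : Matrix ι ι ℂ} (hB : B.det ≠ 0) :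
    Integrable (fun x : ι → ℂ => Real.exp (-∑ i, ‖(B *ᵥ (x - α)) i‖ ^ 2)) :=
  .of_integral_ne_zero (by rw [integral_exp_neg_sum_norm_sq_mulVec_sub α hB]; positivity)

end Gaussian

section Covariance

variable {ι : Type*} {μ : Measure (ι → ℂ)} {α : ι → ℂ} {Q : (ι → ℂ) → ℝ} {S : Matrix ι ι ℂ}

theorem integrable_mul_conj_mul (hQmeas : Measurable Q) (hQnn : ∀ β, 0 ≤ Q β)
    (h : ∀ k, Integrable (fun β => β k * (starRingEnd ℂ) (β k) * (Q β : ℂ)) μ) (j k : ι) :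
    Integrable (fun β => β j * (starRingEnd ℂ) (β k) * (Q β : ℂ)) μ := by
  have hconj : Measurable fun β : ι → ℂ => (starRingEnd ℂ) (β k) :=
    Complex.continuous_conj.measurable.comp (measurable_pi_apply k)
  refine ((h j).norm.add (h k).norm).mono' (by fun_prop) (ae_of_all _ fun β => ?_)
  simp only [Pi.add_apply, norm_mul, RCLike.norm_conj, Complex.norm_real, Real.norm_eq_abs,
    abs_of_nonneg (hQnn β), ← add_mul]
  gcongr
  · exact hQnn β
  · nlinarith [sq_nonneg (‖β j‖ - ‖β k‖), sq_nonneg (‖β j‖ + ‖β k‖)]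

theorem integrable_coord_mul (hQmeas : Measurable Q) (hQnn : ∀ β, 0 ≤ Q β)
    (hQ : Integrable Q μ) {k : ι}
    (h : Integrable (fun β => β k * (starRingEnd ℂ) (β k) * (Q β : ℂ)) μ) :
    Integrable (fun β => β k * (Q β : ℂ)) μ := by
  refine (hQ.norm.add h.norm).mono' (by fun_prop) (ae_of_all _ fun β => ?_)
  simp only [Pi.add_apply, norm_mul, RCLike.norm_conj, Complex.norm_real, Real.norm_eq_abs,
    abs_of_nonneg (hQnn β), ← one_add_mul]
  gcongr
  · exact hQnn β
  · nlinarith [sq_nonneg (‖β k‖ - 1)]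

theorem centered_mul_conj_mul_eq (j k : ι) (β : ι → ℂ) :
    (β - α) j * (starRingEnd ℂ) ((β - α) k) * (Q β : ℂ) =
      β j * (starRingEnd ℂ) (β k) * (Q β : ℂ) - (starRingEnd ℂ) (α k) * (β j * (Q β : ℂ))
        - α j * (starRingEnd ℂ) (β k * (Q β : ℂ))
        + α j * (starRingEnd ℂ) (α k) * (Q β : ℂ) := by
  simp only [Pi.sub_apply, map_sub, map_mul, Complex.conj_ofReal]
  ring

theorem integrable_centered_mul_conj_mul (hQ : Integrable Q μ)
    (h₁ : ∀ k, Integrable (fun β => β k * (Q β : ℂ)) μ)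
    (h₂ : ∀ j k, Integrable (fun β => β j * (starRingEnd ℂ) (β k) * (Q β : ℂ)) μ) (j k : ι) :
    Integrable (fun β => (β - α) j * (starRingEnd ℂ) ((β - α) k) * (Q β : ℂ)) μ := by
  simp only [centered_mul_conj_mul_eq]
  exact (((h₂ j k).sub ((h₁ j).const_mul _)).sub
    ((Complex.conjLIE.integrable_comp_iff.2 (h₁ k)).const_mul _)).add (hQ.ofReal.const_mul _)

theorem integral_centered_mul_conj_mul (hQ : Integrable Q μ)
    (h₁ : ∀ k, Integrable (fun β => β k * (Q β : ℂ)) μ)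
    (h₂ : ∀ j k, Integrable (fun β => β j * (starRingEnd ℂ) (β k) * (Q β : ℂ)) μ)
    (hnorm : ∫ β, Q β ∂μ = 1) (hfirst : ∀ k, ∫ β, β k * (Q β : ℂ) ∂μ = α k)
    (hsecond : ∀ j k, ∫ β, β j * (starRingEnd ℂ) (β k) * (Q β : ℂ) ∂μ = S j k) (j k : ι) :
    ∫ β, (β - α) j * (starRingEnd ℂ) ((β - α) k) * (Q β : ℂ) ∂μ =
      (S - vecMulVec α (star α)) j k := by
  have hc : Integrable (fun β => α j * (starRingEnd ℂ) (β k * (Q β : ℂ))) μ :=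
    (Complex.conjLIE.integrable_comp_iff.2 (h₁ k)).const_mul _
  have hb : Integrable (fun β => (starRingEnd ℂ) (α k) * (β j * (Q β : ℂ))) μ :=
    (h₁ j).const_mul _
  have hab : Integrable (fun β => β j * (starRingEnd ℂ) (β k) * (Q β : ℂ)
      - (starRingEnd ℂ) (α k) * (β j * (Q β : ℂ))) μ := (h₂ j k).sub hb
  have habc : Integrable (fun β => β j * (starRingEnd ℂ) (β k) * (Q β : ℂ)
      - (starRingEnd ℂ) (α k) * (β j * (Q β : ℂ))
      - α j * (starRingEnd ℂ) (β k * (Q β : ℂ))) μ := hab.sub hc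
  have hd : Integrable (fun β => α j * (starRingEnd ℂ) (α k) * (Q β : ℂ)) μ :=
    hQ.ofReal.const_mul _
  simp only [centered_mul_conj_mul_eq]
  rw [integral_add habc hd, integral_sub hab hc, integral_sub (h₂ j k) hb, integral_const_mul,
    integral_const_mul, integral_const_mul, integral_conj, integral_complex_ofReal,
    hfirst, hfirst, hsecond, hnorm]
  simp only [Matrix.sub_apply, vecMulVec_apply, Pi.star_apply, RCLike.star_def,
    Complex.ofReal_one]
  ring

variable [Fintype ι]

theorem ofReal_sum_norm_sq_mulVec (B : Matrix ι ι ℂ) (v : ι → ℂ) :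
    ((∑ i, ‖(B *ᵥ v) i‖ ^ 2 : ℝ) : ℂ) =
      ∑ j, ∑ k, (Bᴴ * B) k j * (v j * (starRingEnd ℂ) (v k)) := by
  simp only [Complex.ofReal_sum, Complex.ofReal_pow, ← Complex.mul_conj', Matrix.mulVec,
    dotProduct, map_sum, map_mul, Finset.sum_mul, Finset.mul_sum, Matrix.mul_apply,
    Matrix.conjTranspose_apply, RCLike.star_def]
  rw [Finset.sum_comm]
  conv_rhs => rw [Finset.sum_comm]
  refine Finset.sum_congr rfl fun j _ => ?_
  rw [Finset.sum_comm]
  exact Finset.sum_congr rfl fun k _ => Finset.sum_congr rfl fun i _ => by ring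

theorem ofReal_sum_norm_sq_mulVec_mul (B : Matrix ι ι ℂ) (v : ι → ℂ) (q : ℝ) :
    (((∑ i, ‖(B *ᵥ v) i‖ ^ 2) * q : ℝ) : ℂ) =
      ∑ j, ∑ k, (Bᴴ * B) k j * (v j * (starRingEnd ℂ) (v k) * (q : ℂ)) := by
  rw [Complex.ofReal_mul, ofReal_sum_norm_sq_mulVec]
  simp only [Finset.sum_mul, mul_assoc]

theorem integrable_sum_norm_sq_mulVec_mul (B : Matrix ι ι ℂ)
    (h : ∀ j k, Integrable (fun β => (β - α) j * (starRingEnd ℂ) ((β - α) k) * (Q β : ℂ)) μ) :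
    Integrable (fun β => (∑ i, ‖(B *ᵥ (β - α)) i‖ ^ 2) * Q β) μ := by
  have hc : Integrable (fun β => (((∑ i, ‖(B *ᵥ (β - α)) i‖ ^ 2) * Q β : ℝ) : ℂ)) μ := by
    simp only [ofReal_sum_norm_sq_mulVec_mul]
    exact integrable_finsetSum _ fun j _ => integrable_finsetSum _ fun k _ => (h j k).const_mul _
  exact hc.re

theorem integral_sum_norm_sq_mulVec_mul (B : Matrix ι ι ℂ)
    (h : ∀ j k, Integrable (fun β => (β - α) j * (starRingEnd ℂ) ((β - α) k) * (Q β : ℂ)) μ)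
    (hS : ∀ j k, ∫ β, (β - α) j * (starRingEnd ℂ) ((β - α) k) * (Q β : ℂ) ∂μ = S j k) :
    ((∫ β, (∑ i, ‖(B *ᵥ (β - α)) i‖ ^ 2) * Q β ∂μ : ℝ) : ℂ) = (Bᴴ * B * S).trace := by
  rw [← integral_complex_ofReal]
  simp only [ofReal_sum_norm_sq_mulVec_mul]
  rw [integral_finsetSum _ fun j _ => integrable_finsetSum _ fun k _ => (h j k).const_mul _]
  simp only [integral_finsetSum _ fun k _ => (h _ k).const_mul _, integral_const_mul, hS]
  rw [Finset.sum_comm]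
  simp only [Matrix.trace, Matrix.diag_apply, Matrix.mul_apply]

end Covariance

section Factorization

open scoped MatrixOrder Matrix.Norms.L2Operator

theorem Matrix.PosSemidef.exists_eq_conjTranspose_mul_self {ι : Type*} [Fintype ι] [DecidableEq ι]
    {A : Matrix ι ι ℂ} (hA : A.PosSemidef) : ∃ B : Matrix ι ι ℂ, A = Bᴴ * B :=
  CStarAlgebra.nonneg_iff_eq_star_mul_self.mp hA.nonneg

end Factorization

theorem MeasureTheory.Integrable.husimiMeasure {N : ℕ} {f : (Fin N → ℂ) → ℝ} (hf : Integrable f) :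
    Integrable f (_root_.husimiMeasure N) :=
  hf.smul_measure (ENNReal.inv_ne_top.2 (pow_ne_zero _ (by simp [Real.pi_pos])))

theorem integral_husimiMeasure {N : ℕ} (f : (Fin N → ℂ) → ℝ) :
    ∫ x, f x ∂(husimiMeasure N) = (Real.pi ^ N)⁻¹ * ∫ x, f x := by
  rw [husimiMeasure, integral_smul_measure, ENNReal.toReal_inv, ENNReal.toReal_pow,
    ENNReal.toReal_ofReal Real.pi_pos.le, smul_eq_mul]

/-- Appendix C: among all Husimi densities `Q` with fixed reduced state
of the field `(r, α)` (with `M := r − α α† + 1` positive definite), the Wehrl entropy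
`−∫ Q log Q dμ` is at most `log det M + N`. -/
theorem wehrl_entropy_le_reduced (N : ℕ) (hN : 1 ≤ N) (α : Fin N → ℂ)
    (r : Matrix (Fin N) (Fin N) ℂ) (hr : r.IsHermitian)
    (hM : (r - Matrix.vecMulVec α (star α) + 1).PosDef)
    (Q : (Fin N → ℂ) → ℝ) (hQmeas : Measurable Q) (hQnn : ∀ β, 0 ≤ Q β)
    (hnorm : ∫ β, Q β ∂(husimiMeasure N) = 1)
    (hfirst : ∀ k, ∫ β, β k * (Q β : ℂ) ∂(husimiMeasure N) = α k)
    (hsecond : ∀ k k', ∫ β, β k * (starRingEnd ℂ) (β k') * (Q β : ℂ) ∂(husimiMeasure N)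
        = r k k' + if k = k' then 1 else 0)
    (hint : Integrable (fun β => Q β * Real.log (Q β)) (husimiMeasure N)) :
    -∫ β, Q β * Real.log (Q β) ∂(husimiMeasure N)
      ≤ Real.log ((r - Matrix.vecMulVec α (star α) + 1).det.re) + N := by
  have hMeq : r - vecMulVec α (star α) + 1 = (r + 1) - vecMulVec α (star α) := by abel
  rw [hMeq] at hM ⊢
  set M := (r + 1) - vecMulVec α (star α)
  replace hsecond : ∀ j k,
      ∫ β, β j * (starRingEnd ℂ) (β k) * (Q β : ℂ) ∂(husimiMeasure N) = (r + 1) j k := fun j k => by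
    rw [hsecond, Matrix.add_apply, Matrix.one_apply]
  have hQ : Integrable Q (husimiMeasure N) := .of_integral_ne_zero (by simp [hnorm])
  have hdiag : ∀ k, Integrable (fun β => β k * (starRingEnd ℂ) (β k) * (Q β : ℂ))
      (husimiMeasure N) := fun k => by
    refine .of_integral_ne_zero ?_
    have hpos : 0 < M k k := hM.diag_pos
    have hle : 0 ≤ α k * star (α k) := mul_star_self_nonneg _
    have : (r + 1) k k = M k k + α k * star (α k) := by simp [M, vecMulVec_apply]
    rw [hsecond, this]
    exact (add_pos_of_pos_of_nonneg hpos hle).ne'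
  have h₂ := integrable_mul_conj_mul hQmeas hQnn hdiag
  have h₁ := fun k => integrable_coord_mul hQmeas hQnn hQ (hdiag k)
  have hcov := integrable_centered_mul_conj_mul (α := α) hQ h₁ h₂
  have hcov_eq := integral_centered_mul_conj_mul hQ h₁ h₂ hnorm hfirst hsecond
  obtain ⟨B, hB⟩ := hM.inv.posSemidef.exists_eq_conjTranspose_mul_self
  have hMunit : IsUnit M.det := hM.det_pos.ne'.isUnit
  have htrace : (Bᴴ * B * M).trace = N := by
    rw [← hB, Matrix.nonsing_inv_mul M hMunit]
    simp
  have hdet : M.det.re = (‖B.det‖ ^ 2)⁻¹ := by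
    have h : M.det⁻¹ = ((‖B.det‖ ^ 2 : ℝ) : ℂ) := by
      rw [← Ring.inverse_eq_inv', ← Matrix.det_nonsing_inv, hB, Matrix.det_mul,
        Matrix.det_conjTranspose, RCLike.star_def, Complex.conj_mul', Complex.ofReal_pow]
    rw [← inv_inv M.det, h, ← Complex.ofReal_inv, Complex.ofReal_re]
  have hdetpos : 0 < M.det.re := (Complex.pos_iff.mp hM.det_pos).1
  have hBdet : B.det ≠ 0 := fun h0 => by simp [hdet, h0] at hdetpos
  set q : (Fin N → ℂ) → ℝ := fun β => ∑ i, ‖(B *ᵥ (β - α)) i‖ ^ 2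
  have hqQ : Integrable (fun β => q β * Q β) (husimiMeasure N) :=
    integrable_sum_norm_sq_mulVec_mul B hcov
  have hqQ_eq : ∫ β, q β * Q β ∂(husimiMeasure N) = N := by
    have h := integral_sum_norm_sq_mulVec_mul B hcov hcov_eq
    rw [htrace] at h
    exact_mod_cast h
  have hlog : ∀ β, Q β * Real.log (M.det.re⁻¹ * Real.exp (-q β)) =
      -(Real.log M.det.re * Q β + q β * Q β) := fun β => by
    rw [Real.log_mul (inv_pos.mpr hdetpos).ne' (Real.exp_pos _).ne', Real.log_inv, Real.log_exp]
    ring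
  have hsum := (hQ.const_mul (Real.log M.det.re)).add hqQ
  calc -∫ β, Q β * Real.log (Q β) ∂(husimiMeasure N)
      ≤ -∫ β, Q β * Real.log (M.det.re⁻¹ * Real.exp (-q β)) ∂(husimiMeasure N) := by
        refine neg_integral_mul_log_self_le hQnn
          (fun β => mul_pos (inv_pos.mpr hdetpos) (Real.exp_pos _)) hQ
          ((integrable_exp_neg_sum_norm_sq_mulVec_sub α hBdet).husimiMeasure.const_mul _)
          (le_of_eq ?_) hint ?_
        · rw [hnorm, integral_const_mul, integral_husimiMeasure,
            integral_exp_neg_sum_norm_sq_mulVec_sub α hBdet, ← hdet, Fintype.card_fin]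
          have := hdetpos.ne'
          have := Real.pi_ne_zero
          field_simp
        · simp only [hlog]
          exact hsum.neg
    _ = Real.log M.det.re + N := by
        simp only [hlog]
        rw [integral_neg, neg_neg, integral_add (hQ.const_mul _) hqQ, integral_const_mul, hnorm,
          hqQ_eq, mul_one]
end

section
/- Let A be a 2N×2N real matrix and V a 2N×2N real symmetric matrix, both regarded as complex matrices. Set y := T A T†, z := T A Tᵀ, r := T V T† − (1/2)·1_N and c := T V Tᵀ. Then T (A V + V Aᵀ) T† = y r + r y† + z c† + c z† + (1/2)(y + y†). (The identity, eq. (A3) of the paper, converting the quadratic part of Gaussian evolution of the matrix of second moments into evolution of the single-particle density matrix and the conjugate field.) -/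
open Matrix
open scoped ComplexOrder

theorem transferMatrix_completeness (N : ℕ) :
    (transferMatrix N)ᴴ * transferMatrix N + (transferMatrix N)ᵀ * (transferMatrix N)ᵀᴴ = 1 := by
  have hsqrt : (Real.sqrt 2 : ℂ)⁻¹ * (Real.sqrt 2 : ℂ)⁻¹ = 1 / 2 := by
    rw [← mul_inv, ← Complex.ofReal_mul, Real.mul_self_sqrt (by norm_num)]
    norm_num
  ext i j
  simp only [Matrix.add_apply, Matrix.mul_apply, ← Finset.sum_add_distrib,
    Matrix.conjTranspose_apply, Matrix.transpose_apply]
  have hi := i.isLt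
  rw [Finset.sum_eq_single (⟨(i : ℕ) / 2, by omega⟩ : Fin N)]
  · simp only [transferMatrix, Matrix.of_apply, Matrix.one_apply, Fin.ext_iff]
    split_ifs <;> first
      | omega
      | (simp only [star_mul', Complex.star_def, Complex.conj_I, map_inv₀, Complex.conj_ofReal,
          map_zero, mul_zero, add_zero] <;> first
          | ring1
          | linear_combination 2 * hsqrt
          | linear_combination 2 * hsqrt - 2 * (Real.sqrt 2 : ℂ)⁻¹ ^ 2 * Complex.I_sq)
  · intro k _ hk
    have hk' : (k : ℕ) ≠ (i : ℕ) / 2 := fun h => hk (Fin.ext h)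
    have h0 : transferMatrix N k i = 0 := by
      simp only [transferMatrix, Matrix.of_apply]
      rw [if_neg (by omega), if_neg (by omega)]
    simp [h0]
  · simp

theorem Matrix.conjTranspose_eq_transpose_of_im_eq_zero {m n : Type*} (M : Matrix m n ℂ)
    (hM : ∀ i j, (M i j).im = 0) : Mᴴ = Mᵀ := by
  ext i j
  exact Complex.conj_eq_iff_im.mpr (hM j i)

/-- eq. (A3), quadratic part: for `A` a `2N×2N` real matrix and `V` a
`2N×2N` real symmetric matrix, with `y := T A T†`, `z := T A Tᵀ`,
`r := T V T† − (1/2)·1`, `c := T V Tᵀ`, one has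
`T (A V + V Aᵀ) T† = y r + r y† + z c† + c z† + (1/2)(y + y†)`. -/
theorem gaussian_quadratic_evolution_RSF (N : ℕ) (hN : 1 ≤ N)
    (A V : Matrix (Fin (2 * N)) (Fin (2 * N)) ℂ)
    (hA : ∀ i j, (A i j).im = 0)
    (hVreal : ∀ i j, (V i j).im = 0) (hVsym : Vᵀ = V) :
    ∀ y z r c : Matrix (Fin N) (Fin N) ℂ,
      y = transferMatrix N * A * (transferMatrix N)ᴴ →
      z = transferMatrix N * A * (transferMatrix N)ᵀ →
      r = transferMatrix N * V * (transferMatrix N)ᴴ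
          - (1 / 2 : ℂ) • (1 : Matrix (Fin N) (Fin N) ℂ) →
      c = transferMatrix N * V * (transferMatrix N)ᵀ →
      transferMatrix N * (A * V + V * Aᵀ) * (transferMatrix N)ᴴ
        = y * r + r * yᴴ + z * cᴴ + c * zᴴ + (1 / 2 : ℂ) • (y + yᴴ) := by
  rintro y z r c rfl rfl rfl rfl
  have hT := transferMatrix_completeness N
  have hAH := A.conjTranspose_eq_transpose_of_im_eq_zero hA
  have hVH := V.conjTranspose_eq_transpose_of_im_eq_zero hVreal
  rw [hVsym] at hVH
  generalize transferMatrix N = T at *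
  have key (X Y : Matrix (Fin (2 * N)) (Fin (2 * N)) ℂ) :
      T * X * Tᴴ * (T * Y * Tᴴ) + T * X * Tᵀ * (Tᵀᴴ * Y * Tᴴ) = T * (X * Y) * Tᴴ := by
    calc _ = T * X * (Tᴴ * T + Tᵀ * Tᵀᴴ) * Y * Tᴴ := by
          simp only [Matrix.mul_add, Matrix.add_mul, Matrix.mul_assoc]
      _ = _ := by rw [hT]; simp only [Matrix.mul_one, Matrix.mul_assoc]
  simp only [Matrix.conjTranspose_mul, Matrix.conjTranspose_conjTranspose, hAH, hVH,
    Matrix.mul_add, Matrix.add_mul, Matrix.mul_sub, Matrix.sub_mul, Matrix.mul_smul,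
    Matrix.smul_mul, Matrix.mul_one, Matrix.one_mul, smul_add]
  rw [← key A V, ← key V Aᵀ]
  simp only [Matrix.mul_assoc]
  abel
end
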